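/- Let T be a full binary tree with n nodes and let 1 < m ≤ n. Then every connected component of the graph obtained from T by removing all m-critical nodes is of the form T[p] for some pattern p (an m-bridge), and every m-bridge has size at most m. -/

import Mathlib

/-- A finite rooted ordered tree, given by its finite, prefix-closed set of node
positions; a position is the list of child directions from the root. -/
structure PosTree (k : ℕ) where
  nodes : Finset (List (Fin k))
  root_mem : [] ∈ nodes
  prefix_closed : ∀ u v : List (Fin k), u <+: v → v ∈ nodes → u ∈ nodes

/-- A full binary tree: every node has either no children or both children. -/
def PosTree.IsFullBinary (T : PosTree 2) : Prop :=
  ∀ v ∈ T.nodes, ∀ i j : Fin 2, v ++ [i] ∈ T.nodes → v ++ [j] ∈ T.nodes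

/-- A pattern in a tree: either a subtree pattern (a single node) or a context
pattern (a pair of a node and a proper descendant). -/
inductive Pattern (k : ℕ) : Type
  | subtree : List (Fin k) → Pattern k
  | context : List (Fin k) → List (Fin k) → Pattern k
deriving DecidableEq

/-- Validity of a pattern in a tree `T`. -/
def Pattern.Valid {k : ℕ} (T : PosTree k) : Pattern k → Prop
  | .subtree v => v ∈ T.nodes
  | .context v w => v ∈ T.nodes ∧ w ∈ T.nodes ∧ v <+: w ∧ v ≠ w

/-- The set `V[p]` of nodes covered by a pattern. -/
def Pattern.cover {k : ℕ} (T : PosTree k) : Pattern k → Set (List (Fin k))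
  | .subtree v => {u | u ∈ T.nodes ∧ v <+: u}
  | .context v w => {u | u ∈ T.nodes ∧ v <+: u ∧ ¬ w <+: u}

/-- `|T[v]|`: the number of nodes of the subtree of `T` rooted at `v`. -/
noncomputable def PosTree.subSize {k : ℕ} (T : PosTree k) (v : List (Fin k)) : ℕ :=
  {u | u ∈ T.nodes ∧ v <+: u}.ncard

/-- Ceiling division of natural numbers, `⌈a/m⌉`. -/
def cdiv (a m : ℕ) : ℕ := (a + m - 1) / m

/-- An inner node `v` of the full binary tree `T` is `m`-critical if
`⌈|T[v]|/m⌉ ≠ ⌈|T[w]|/m⌉` for every child `w` of `v`. -/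
def PosTree.Critical (T : PosTree 2) (m : ℕ) (v : List (Fin 2)) : Prop :=
  v ∈ T.nodes ∧ v ++ [(0 : Fin 2)] ∈ T.nodes ∧
    ∀ i : Fin 2, cdiv (T.subSize v) m ≠ cdiv (T.subSize (v ++ [i])) m

/-- Two nodes are adjacent in `T` if one is a child of the other. -/
def PosTree.Adj {k : ℕ} (T : PosTree k) (u v : List (Fin k)) : Prop :=
  u ∈ T.nodes ∧ v ∈ T.nodes ∧ ((∃ i : Fin k, v = u ++ [i]) ∨ ∃ i : Fin k, u = v ++ [i])

/-- Connectivity in the subgraph of `T` induced by the non-`m`-critical nodes. -/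
def PosTree.ConnOffCrit (T : PosTree 2) (m : ℕ) (u v : List (Fin 2)) : Prop :=
  Relation.ReflTransGen
    (fun a b => ¬ T.Critical m a ∧ ¬ T.Critical m b ∧ T.Adj a b) u v

theorem cdiv_le_iff' {a m k : ℕ} (hm : 0 < m) : cdiv a m ≤ k ↔ a ≤ k * m := by
  unfold cdiv
  rw [← Nat.lt_succ_iff, Nat.div_lt_iff_lt_mul hm, Nat.succ_mul]
  omega

theorem cdiv_mono' {a b m : ℕ} (hm : 0 < m) (h : a ≤ b) : cdiv a m ≤ cdiv b m :=
  (cdiv_le_iff' hm).2 (h.trans ((cdiv_le_iff' hm).1 le_rfl))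

theorem sub_finite (T : PosTree 2) (P : List (Fin 2) → Prop) :
    {u | u ∈ T.nodes ∧ P u}.Finite :=
  T.nodes.finite_toSet.subset (fun _ h => h.1)

theorem subSize_mono (T : PosTree 2) {v w : List (Fin 2)} (h : v <+: w) :
    T.subSize w ≤ T.subSize v :=
  Set.ncard_le_ncard (fun _ hu => ⟨hu.1, h.trans hu.2⟩) (sub_finite T _)

theorem subSize_pos (T : PosTree 2) {v : List (Fin 2)} (h : v ∈ T.nodes) :
    1 ≤ T.subSize v :=
  (Set.ncard_pos (sub_finite T _)).2 ⟨v, h, List.prefix_refl v⟩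

/-- The subtree below `r` minus the part below `w`. -/
theorem cover_add (T : PosTree 2) {r w : List (Fin 2)} (h : r <+: w) :
    {u | u ∈ T.nodes ∧ r <+: u ∧ ¬ w <+: u}.ncard + T.subSize w = T.subSize r := by
  unfold PosTree.subSize
  rw [← Set.ncard_union_eq _ (sub_finite T _) (sub_finite T _)]
  · congr 1
    ext u
    simp only [Set.mem_union, Set.mem_setOf_eq]
    constructor
    · rintro (h1 | h1)
      · exact ⟨h1.1, h1.2.1⟩
      · exact ⟨h1.1, h.trans h1.2⟩
    · rintro ⟨h1, h2⟩
      by_cases h3 : w <+: u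
      · exact Or.inr ⟨h1, h3⟩
      · exact Or.inl ⟨h1, h2, h3⟩
  · rw [Set.disjoint_left]
    rintro u h1 h2
    exact h1.2.2 h2.2

theorem not_crit_small (T : PosTree 2) {m : ℕ} (hm : 0 < m) {x : List (Fin 2)}
    (hx : T.subSize x ≤ m) : ¬ T.Critical m x := by
  rintro ⟨_, h0, hc⟩
  apply hc 0
  have key : ∀ y, y ∈ T.nodes → T.subSize y ≤ m → cdiv (T.subSize y) m = 1 := by
    intro y hy hs
    have h1 : cdiv (T.subSize y) m ≤ 1 := (cdiv_le_iff' hm).2 (by omega)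
    have h2 : ¬ cdiv (T.subSize y) m ≤ 0 := by
      rw [cdiv_le_iff' hm]
      have := subSize_pos T hy
      omega
    omega
  have hp : x <+: x ++ [(0 : Fin 2)] := List.prefix_append _ _
  rw [key _ (T.prefix_closed _ _ hp h0) hx, key _ h0 ((subSize_mono T hp).trans hx)]

/-- Nodes below `r` reachable from `r` downwards without critical nodes. -/
def downSet (T : PosTree 2) (m : ℕ) (r : List (Fin 2)) : Set (List (Fin 2)) :=
  {v | v ∈ T.nodes ∧ r <+: v ∧ ∀ x, r <+: x → x <+: v → ¬ T.Critical m x}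

theorem exists_top (T : PosTree 2) (m : ℕ) (u : List (Fin 2)) :
    u ∈ T.nodes → ¬ T.Critical m u →
    ∃ r, u ∈ downSet T m r ∧ ∀ b i, r = b ++ [i] → T.Critical m b := by
  have self : ∀ u, u ∈ T.nodes → ¬ T.Critical m u → u ∈ downSet T m u := by
    intro u hu hc
    refine ⟨hu, List.prefix_refl u, fun x h1 h2 => ?_⟩
    rwa [h2.eq_of_length_le h1.length_le]
  induction u using List.reverseRecOn with
  | nil => 
    intro hu hc
    exact ⟨[], self _ hu hc, by simp⟩
  | append_singleton b i ih =>
    intro hu hc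
    by_cases hb : T.Critical m b
    · refine ⟨_, self _ hu hc, ?_⟩
      intro b' j h
      rwa [← (List.append_inj' h rfl).1]
    · obtain ⟨r, h1, h2⟩ := ih (T.prefix_closed _ _ (List.prefix_append _ _) hu) hb
      refine ⟨r, ⟨hu, h1.2.1.trans (List.prefix_append _ _), fun x hx hx' => ?_⟩, h2⟩
      rcases List.prefix_concat_iff.1 hx' with h | h
      · rwa [h]
      · exact h1.2.2 x hx h

theorem conn_symm (T : PosTree 2) (m : ℕ) {u v : List (Fin 2)}
    (h : T.ConnOffCrit m u v) : T.ConnOffCrit m v u := by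
  induction h with
  | refl => exact Relation.ReflTransGen.refl
  | tail _ h2 ih =>
    exact Relation.ReflTransGen.head ⟨h2.2.1, h2.1, h2.2.2.2.1, h2.2.2.1, h2.2.2.2.2.symm⟩ ih

theorem conn_top (T : PosTree 2) (m : ℕ) (r v : List (Fin 2)) :
    v ∈ downSet T m r → T.ConnOffCrit m r v := by
  induction v using List.reverseRecOn with
  | nil =>
    intro h
    rw [List.prefix_nil.1 h.2.1]
    exact Relation.ReflTransGen.refl
  | append_singleton b i ih =>
    rintro ⟨h1, h2, h3⟩
    rcases List.prefix_concat_iff.1 h2 with h | h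
    · rw [h]
      exact Relation.ReflTransGen.refl
    · have hp : b <+: b ++ [i] := List.prefix_append _ _
      have hb := T.prefix_closed _ _ hp h1
      refine Relation.ReflTransGen.tail (ih ⟨hb, h, fun x hx hx' => h3 x hx (hx'.trans hp)⟩) ?_
      exact ⟨h3 _ h hp, h3 _ h2 (List.prefix_refl _), hb, h1, Or.inl ⟨i, rfl⟩⟩

theorem comp_eq (T : PosTree 2) (m : ℕ) {u r : List (Fin 2)} (hu : u ∈ downSet T m r)
    (hr : ∀ b i, r = b ++ [i] → T.Critical m b) :
    {v | T.ConnOffCrit m u v} = downSet T m r := by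
  ext v
  constructor
  · intro h
    change T.ConnOffCrit m u v at h
    induction h with
    | refl => exact hu
    | @tail a b _ h2 ih =>
      obtain ⟨ha, hb, -, hbn, ⟨i, h⟩ | ⟨i, h⟩⟩ := h2
      · subst h
        refine ⟨hbn, ih.2.1.trans (List.prefix_append _ _), fun x hx hx' => ?_⟩
        rcases List.prefix_concat_iff.1 hx' with h | h
        · rwa [h]
        · exact ih.2.2 x hx h
      · subst h
        rcases List.prefix_concat_iff.1 ih.2.1 with h | h
        · exact absurd (hr _ _ h) hb
        · exact ⟨hbn, h, fun x hx hx' => ih.2.2 x hx (hx'.trans (List.prefix_append _ _))⟩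
  · intro h
    exact Relation.ReflTransGen.trans (conn_symm T m (conn_top T m r u hu)) (conn_top T m r v h)

theorem exists_bottom (T : PosTree 2) (hT : T.IsFullBinary) {m : ℕ} (h1 : 1 < m)
    {r : List (Fin 2)} (hr : r ∈ T.nodes) (hs : m < T.subSize r) :
    ∃ w ∈ T.nodes, r <+: w ∧ T.Critical m w ∧
      cdiv (T.subSize w) m = cdiv (T.subSize r) m := by
  classical
  have hm : 0 < m := by omega
  obtain ⟨w, hw, hmax⟩ := Finset.exists_max_image
    (T.nodes.filter (fun w => r <+: w ∧ cdiv (T.subSize w) m = cdiv (T.subSize r) m))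
    List.length ⟨r, by simp [hr]⟩
  simp only [Finset.mem_filter] at hw hmax
  obtain ⟨hwn, hrw, hc⟩ := hw
  refine ⟨w, hwn, hrw, ?_, hc⟩
  have hbig : m < T.subSize w := by
    by_contra hcon
    have h2 : cdiv (T.subSize w) m ≤ 1 := (cdiv_le_iff' hm).2 (by omega)
    rw [hc, cdiv_le_iff' hm] at h2
    omega
  obtain ⟨u, hu, hne⟩ := Set.exists_ne_of_one_lt_ncard
    (show 1 < {u | u ∈ T.nodes ∧ w <+: u}.ncard from h1.trans hbig) w
  have hch : ∀ j, w ++ [j] ∈ T.nodes := by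
    obtain ⟨hun, t, rfl⟩ := hu
    cases t with
    | nil => simp at hne
    | cons i t =>
      intro j
      exact hT w hwn i j (T.prefix_closed _ _ ⟨t, by simp⟩ hun)
  refine ⟨hwn, hch 0, fun i hi => ?_⟩
  have := hmax (w ++ [i]) ⟨hch i, hrw.trans (List.prefix_append _ _), hi.symm.trans hc⟩
  simp at this

theorem stmt10 (T : PosTree 2) (hT : T.IsFullBinary) (n m : ℕ)
    (hn : n = T.nodes.card) (h1 : 1 < m) (h2 : m ≤ n) :
    ∀ u ∈ T.nodes, ¬ T.Critical m u →
      ∃ p : Pattern 2, p.Valid T ∧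
        {v | T.ConnOffCrit m u v} = p.cover T ∧
        (p.cover T).ncard ≤ m := by
  intro u hu hcu
  have hm : 0 < m := by omega
  obtain ⟨r, hur, hr⟩ := exists_top T m u hu hcu
  rw [comp_eq T m hur hr]
  have hrn : r ∈ T.nodes := T.prefix_closed _ _ hur.2.1 hu
  have hrc : ¬ T.Critical m r := hur.2.2 r (List.prefix_refl r) hur.2.1
  by_cases hs : T.subSize r ≤ m
  · refine ⟨.subtree r, hrn, ?_, hs⟩
    ext v
    constructor
    · exact fun h => ⟨h.1, h.2.1⟩
    · exact fun h => ⟨h.1, h.2, fun x hx _ => not_crit_small T hm ((subSize_mono T hx).trans hs)⟩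
  · obtain ⟨w, hwn, hrw, hwc, hk⟩ := exists_bottom T hT h1 hrn (not_le.1 hs)
    have hadd := cover_add T hrw
    have hsz : T.subSize r ≤ T.subSize w + m := by
      obtain ⟨k, hk'⟩ : ∃ k, cdiv (T.subSize r) m = k := ⟨_, rfl⟩
      have ha : T.subSize r ≤ k * m := (cdiv_le_iff' hm).1 hk'.le
      cases k with
      | zero => omega
      | succ k =>
        have hb : ¬ T.subSize w ≤ k * m := by
          rw [← cdiv_le_iff' hm]
          omega
        rw [Nat.succ_mul] at ha
        omega
    have hcard : {u | u ∈ T.nodes ∧ r <+: u ∧ ¬ w <+: u}.ncard ≤ m := by omega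
    refine ⟨.context r w, ⟨hrn, hwn, hrw, ?_⟩, ?_, hcard⟩
    · rintro rfl
      exact hrc hwc
    ext v
    constructor
    · exact fun h => ⟨h.1, h.2.1, fun hw => h.2.2 w hrw hw hwc⟩
    · rintro ⟨hv, hrv, hwv⟩
      refine ⟨hv, hrv, fun x hrx hxv hxc => ?_⟩
      by_cases hxw : x <+: w
      · obtain ⟨t, rfl⟩ := hxw
        cases t with
        | nil => exact hwv (by simpa using hxv)
        | cons i t =>
          apply hxc.2.2 i
          have e1 := cdiv_mono' hm (subSize_mono T hrx)
          have e2 := cdiv_mono' hm (subSize_mono T (List.prefix_append x [i]))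
          have e3 := cdiv_mono' hm (subSize_mono T
            (show x ++ [i] <+: x ++ i :: t from ⟨t, by simp⟩))
          omega
      · refine not_crit_small T hm (le_trans ?_ hcard) hxc
        refine Set.ncard_le_ncard ?_ (sub_finite T _)
        rintro y ⟨hy, hxy⟩
        refine ⟨hy, hrx.trans hxy, fun hwy => ?_⟩
        rcases List.prefix_or_prefix_of_prefix hxy hwy with h | h
        · exact hxw h
        · exact hwv (h.trans hxv)
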